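/- Writing P^k(t) ⊆ R for the set of 𝔽_q-polynomials in t of degree at most k, the stabilizer subgroups admit the following explicit descriptions: (i) for m > 0, Γ̄_{m,0} is the image in PGL(3,F) of the set of invertible matrices ((a₁₁,a₁₂,a₁₃),(0,a₂₂,a₂₃),(0,a₃₂,a₃₃)) with a₁₁,a₂₂,a₂₃,a₃₂,a₃₃ ∈ 𝔽_q and a₁₂,a₁₃ ∈ P^m(t); (ii) for m > n > 0, Γ̄_{m,n} is the image of the set of invertible upper-triangular matrices ((a₁₁,a₁₂,a₁₃),(0,a₂₂,a₂₃),(0,0,a₃₃)) with a₁₁,a₂₂,a₃₃ ∈ 𝔽_q, a₁₂ ∈ P^{m−n}(t), a₁₃ ∈ P^m(t) and a₂₃ ∈ P^n(t); (iii) for m > 0, Γ̄_{m,m} is the image of the set of invertible matrices ((a₁₁,a₁₂,a₁₃),(a₂₁,a₂₂,a₂₃),(0,0,a₃₃)) with a₁₁,a₁₂,a₂₁,a₂₂,a₃₃ ∈ 𝔽_q and a₁₃,a₂₃ ∈ P^m(t). -/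

import Mathlib

set_option linter.unusedSectionVars false

noncomputable section

open Matrix Polynomial

variable (K : Type) [Field K] [Fintype K]

/-- `u ∈ 𝔽_q((u))`, playing the role of `t⁻¹`. -/
def uu : LaurentSeries K := HahnSeries.single 1 1

/-- `t = u⁻¹`, so that `LaurentSeries K` is identified with `𝔽_q((t⁻¹))`. -/
def tt : LaurentSeries K := (uu K)⁻¹

/-- The valuation ring `O = 𝔽_q[[t⁻¹]]`, the subring of power series in `u`. -/
def Osub : Subring (LaurentSeries K) := (HahnSeries.ofPowerSeries ℤ K).range

/-- The ring `R = 𝔽_q[t]`, the image of the polynomial ring under `X ↦ t`. -/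
def Rsub : Subring (LaurentSeries K) :=
  (Polynomial.eval₂RingHom (HahnSeries.C : K →+* LaurentSeries K) (tt K)).range

/-- Membership in `Γ_d`: all entries of `g` and of `g⁻¹` lie in `R = 𝔽_q[t]`. -/
def memGamma {d : ℕ} (g : GL (Fin d) (LaurentSeries K)) : Prop :=
  (∀ i j, (g : Matrix (Fin d) (Fin d) (LaurentSeries K)) i j ∈ Rsub K) ∧
  (∀ i j, ((g⁻¹ : GL (Fin d) (LaurentSeries K)) : Matrix (Fin d) (Fin d) (LaurentSeries K)) i j
      ∈ Rsub K)

/-- Membership in `W_d`: all entries of `g` and of `g⁻¹` lie in `O = 𝔽_q[[t⁻¹]]`. -/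
def memW {d : ℕ} (g : GL (Fin d) (LaurentSeries K)) : Prop :=
  (∀ i j, (g : Matrix (Fin d) (Fin d) (LaurentSeries K)) i j ∈ Osub K) ∧
  (∀ i j, ((g⁻¹ : GL (Fin d) (LaurentSeries K)) : Matrix (Fin d) (Fin d) (LaurentSeries K)) i j
      ∈ Osub K)

/-- The subgroup of scalar matrices in `GL(3,F)`. -/
def scalarSubgroup : Subgroup (GL (Fin 3) (LaurentSeries K)) :=
  (Units.map ((Matrix.scalar (Fin 3) :
      LaurentSeries K →+* Matrix (Fin 3) (Fin 3) (LaurentSeries K))).toMonoidHom).range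

instance scalarSubgroup_normal : (scalarSubgroup K).Normal := by
  constructor
  intro x hx g
  obtain ⟨c, rfl⟩ := hx
  refine ⟨c, ?_⟩
  have h : Commute ((Matrix.scalar (Fin 3)) (c : LaurentSeries K))
      (g : Matrix (Fin 3) (Fin 3) (LaurentSeries K)) :=
    Matrix.scalar_commute (c : LaurentSeries K) (fun r => Commute.all _ r) _
  symm
  rw [mul_inv_eq_iff_eq_mul]
  apply Units.ext
  simpa [Units.coe_map] using h.eq.symm

/-- `PGL(3,F)`, the quotient of `GL(3,F)` by the subgroup of scalar matrices. -/
def PGL3 := GL (Fin 3) (LaurentSeries K) ⧸ scalarSubgroup K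

instance : Group (PGL3 K) := QuotientGroup.Quotient.group (scalarSubgroup K)

/-- The projection `GL(3,F) → PGL(3,F)`. -/
def projPGL : GL (Fin 3) (LaurentSeries K) →* PGL3 K := QuotientGroup.mk' (scalarSubgroup K)

/-- `Γ̄`, the image of `Γ₃` in `PGL(3,F)`. -/
def GammaBar : Set (PGL3 K) := projPGL K '' {g | memGamma K g}

/-- `W̄`, the image of `W₃` in `PGL(3,F)`. -/
def WBar : Set (PGL3 K) := projPGL K '' {g | memW K g}

lemma tt_ne_zero : tt K ≠ 0 := by
  have h : uu K ≠ 0 := HahnSeries.single_ne_zero one_ne_zero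
  simpa [tt] using inv_ne_zero h

lemma diag_det_ne_zero (m n : ℕ) :
    (Matrix.diagonal ![tt K ^ m, tt K ^ n, 1] :
      Matrix (Fin 3) (Fin 3) (LaurentSeries K)).det ≠ 0 := by
  rw [Matrix.det_diagonal]
  simp [Fin.prod_univ_three, pow_ne_zero, tt_ne_zero K]

/-- `x̄_{m,n} ∈ PGL(3,F)`, the image of the diagonal matrix `diag(t^m, t^n, 1)`. -/
def xbar (m n : ℕ) : PGL3 K :=
  projPGL K (Matrix.GeneralLinearGroup.mkOfDetNeZero _ (diag_det_ne_zero K m n))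

/-- The stabilizer `Γ̄_{m,n} = {γ ∈ Γ̄ : x̄_{m,n}⁻¹ γ x̄_{m,n} ∈ W̄}`. -/
def stab (m n : ℕ) : Set (PGL3 K) :=
  {γ ∈ GammaBar K | (xbar K m n)⁻¹ * γ * xbar K m n ∈ WBar K}

/-- The constants `𝔽_q ⊆ F`. -/
def Fqconst : Subring (LaurentSeries K) := (HahnSeries.C : K →+* LaurentSeries K).range

/-- `P^k(t)`: polynomials in `t` of degree at most `k`. -/
def Pdeg (k : ℕ) : Set (LaurentSeries K) :=
  {x | ∃ p : Polynomial K, p.natDegree ≤ k ∧ Polynomial.eval₂ HahnSeries.C (tt K) p = x}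

lemma tt_eq_single : tt K = HahnSeries.single (-1) 1 := by
  rw [tt, uu, HahnSeries.inv_single]; simp

lemma tt_pow_eq (n : ℕ) : tt K ^ n = HahnSeries.single (-(n : ℤ)) 1 := by
  rw [tt_eq_single, HahnSeries.single_pow]; simp

lemma tt_pow_inv_eq (n : ℕ) : (tt K ^ n)⁻¹ = HahnSeries.single (n : ℤ) 1 := by
  rw [tt_pow_eq, HahnSeries.inv_single]; simp

lemma coeff_eval (p : Polynomial K) (k : ℤ) :
    (Polynomial.eval₂ (HahnSeries.C : K →+* LaurentSeries K) (tt K) p).coeff k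
      = if k ≤ 0 then p.coeff (-k).toNat else 0 := by
  induction p using Polynomial.induction_on' with
  | add p q hp hq =>
    rw [Polynomial.eval₂_add, HahnSeries.coeff_add, hp, hq]
    split_ifs <;> simp
  | monomial n a =>
    rw [Polynomial.eval₂_monomial, tt_pow_eq, HahnSeries.C_apply, HahnSeries.single_mul_single,
      HahnSeries.coeff_single, Polynomial.coeff_monomial]
    simp only [zero_add, mul_one]
    split_ifs <;> first | rfl | (exfalso; omega)

lemma eval_inj (p q : Polynomial K)
    (h : Polynomial.eval₂ (HahnSeries.C : K →+* LaurentSeries K) (tt K) p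
      = Polynomial.eval₂ (HahnSeries.C : K →+* LaurentSeries K) (tt K) q) : p = q := by
  ext n
  have := congrArg (fun x => HahnSeries.coeff x (-(n : ℤ))) h
  simpa [coeff_eval] using this

lemma mem_O_iff (x : LaurentSeries K) : x ∈ Osub K ↔ ∀ k < 0, x.coeff k = 0 := by
  constructor
  · rintro ⟨f, rfl⟩ k hk
    exact PowerSeries.coeff_coe f k |>.trans (by simp [hk])
  · intro h
    refine ⟨PowerSeries.mk fun n => x.coeff n, ?_⟩
    ext k
    refine (PowerSeries.coeff_coe _ k).trans ?_
    split_ifs with hk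
    · exact (h k hk).symm
    · rw [PowerSeries.coeff_mk]
      congr 1
      omega

lemma mem_O_iff_val (x : LaurentSeries K) : x ∈ Osub K ↔ Valued.v x ≤ (1 : WithZero (Multiplicative ℤ)) :=
  (LaurentSeries.val_le_one_iff_eq_coe K x).symm

lemma O_of_cube (c : LaurentSeries K) (h : c ^ 3 ∈ Osub K) : c ∈ Osub K := by
  rw [mem_O_iff_val] at *
  rw [map_pow] at h
  exact (pow_le_one_iff (by norm_num)).1 h

lemma O_inv_of_val {x y : LaurentSeries K} (h : x * y = 1) : y = x⁻¹ :=
  eq_inv_of_mul_eq_one_right h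

lemma Fq_le_O {x : LaurentSeries K} (h : x ∈ Fqconst K) : x ∈ Osub K := by
  obtain ⟨a, rfl⟩ := h
  rw [mem_O_iff]
  intro k hk
  rw [HahnSeries.C_apply, HahnSeries.coeff_single, if_neg hk.ne]

lemma Fq_le_R {x : LaurentSeries K} (h : x ∈ Fqconst K) : x ∈ Rsub K := by
  obtain ⟨a, rfl⟩ := h
  exact ⟨Polynomial.C a, by simp⟩

lemma Fq_inv {x : LaurentSeries K} (h : x ∈ Fqconst K) : x⁻¹ ∈ Fqconst K := by
  obtain ⟨a, rfl⟩ := h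
  exact ⟨a⁻¹, by simp⟩

lemma R_unit {x : LaurentSeries K} (h0 : x ≠ 0) (h : x ∈ Rsub K) (h' : x⁻¹ ∈ Rsub K) :
    x ∈ Fqconst K := by
  obtain ⟨p, rfl⟩ := h
  obtain ⟨q, hq⟩ := h'
  have h1 : p * q = 1 := by
    apply eval_inj K
    have : Polynomial.eval₂RingHom (HahnSeries.C : K →+* LaurentSeries K) (tt K) (p * q) = 1 := by
      rw [map_mul, hq, mul_inv_cancel₀ h0]
    simpa using this
  obtain ⟨a, -, ha⟩ := Polynomial.isUnit_iff.1 (IsUnit.of_mul_eq_one _ h1)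
  exact ⟨a, by simp [← ha]⟩

/-- the entry condition: degree at most `i - j` -/
lemma entry_iff (i j : ℕ) (p : Polynomial K) :
    (tt K ^ i)⁻¹ * Polynomial.eval₂ (HahnSeries.C : K →+* LaurentSeries K) (tt K) p * tt K ^ j
      ∈ Osub K ↔ ∀ n : ℕ, i < n + j → p.coeff n = 0 := by
  have key : ∀ k : ℤ, ((tt K ^ i)⁻¹ *
      Polynomial.eval₂ (HahnSeries.C : K →+* LaurentSeries K) (tt K) p * tt K ^ j).coeff k
      = (Polynomial.eval₂ (HahnSeries.C : K →+* LaurentSeries K) (tt K) p).coeff (k - i + j) := by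
    intro k
    rw [tt_pow_inv_eq, tt_pow_eq, mul_comm, ← mul_assoc, HahnSeries.single_mul_single]
    have := HahnSeries.coeff_single_mul_add (r := (1 * 1 : K))
      (x := Polynomial.eval₂ (HahnSeries.C : K →+* LaurentSeries K) (tt K) p)
      (a := k - i + j) (b := -(j : ℤ) + i)
    rw [show k - i + j + (-(j : ℤ) + i) = k by ring] at this
    rw [this]; simp
  rw [mem_O_iff]
  constructor
  · intro h n hn
    have := h (i - j - n) (by omega)
    rw [key, coeff_eval, if_pos (by omega)] at this
    convert this using 2
    omega
  · intro h k hk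
    rw [key, coeff_eval]
    split_ifs with h1
    · exact h _ (by omega)
    · rfl

def Ent (i j : ℕ) (x : LaurentSeries K) : Prop :=
  x ∈ Rsub K ∧ (tt K ^ i)⁻¹ * x * tt K ^ j ∈ Osub K

lemma ent_P (i j k : ℕ) (h : i = k + j) (x : LaurentSeries K) : Ent K i j x ↔ x ∈ Pdeg K k := by
  constructor
  · rintro ⟨⟨p, rfl⟩, h2⟩
    refine ⟨p, ?_, rfl⟩
    have h3 := (entry_iff K i j p).1 h2
    exact Polynomial.natDegree_le_iff_coeff_eq_zero.2 fun n hn => h3 n (by omega)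
  · rintro ⟨p, hp, rfl⟩
    refine ⟨⟨p, rfl⟩, (entry_iff K i j p).2 fun n hn => ?_⟩
    exact Polynomial.natDegree_le_iff_coeff_eq_zero.1 hp n (by omega)

lemma ent_Fq (i : ℕ) (x : LaurentSeries K) : Ent K i i x ↔ x ∈ Fqconst K := by
  rw [ent_P K i i 0 (by simp)]
  constructor
  · rintro ⟨p, hp, rfl⟩
    rw [Polynomial.eq_C_of_natDegree_le_zero hp]
    exact ⟨p.coeff 0, by simp⟩
  · rintro ⟨a, rfl⟩
    exact ⟨Polynomial.C a, by simp, by simp⟩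

lemma ent_zero (i j : ℕ) (h : i < j) (x : LaurentSeries K) : Ent K i j x ↔ x = 0 := by
  constructor
  · rintro ⟨⟨p, rfl⟩, h2⟩
    have h3 := (entry_iff K i j p).1 h2
    have : p = 0 := by
      ext n
      simpa using h3 n (by omega)
    simp [this]
  · rintro rfl
    exact ⟨zero_mem _, by simp⟩

lemma det_mem (S : Subring (LaurentSeries K)) (M : Matrix (Fin 3) (Fin 3) (LaurentSeries K))
    (h : ∀ i j, M i j ∈ S) : M.det ∈ S := by
  rw [Matrix.det_apply']
  refine sum_mem fun σ _ => mul_mem (intCast_mem _ _) (prod_mem fun i _ => h _ _)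

lemma inv_mem_sub (S : Subring (LaurentSeries K)) (M : Matrix (Fin 3) (Fin 3) (LaurentSeries K))
    (h : ∀ i j, M i j ∈ S) (hd : M.det⁻¹ ∈ S) : ∀ i j, M⁻¹ i j ∈ S := by
  intro i j
  rw [Matrix.inv_def, Matrix.smul_apply, Ring.inverse_eq_inv', smul_eq_mul]
  refine mul_mem hd ?_
  rw [Matrix.adjugate_apply]
  refine det_mem K S _ fun a b => ?_
  by_cases hab : a = j
  · subst hab
    rw [Matrix.updateRow_self]
    by_cases hb : b = i
    · subst hb; simp [one_mem]
    · simp [Pi.single_apply, hb, zero_mem]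
  · rw [Matrix.updateRow_ne hab]; exact h a b

def xx (m n : ℕ) : GL (Fin 3) (LaurentSeries K) :=
  Matrix.GeneralLinearGroup.mkOfDetNeZero _ (diag_det_ne_zero K m n)

lemma xx_coe (m n : ℕ) : ((xx K m n : GL (Fin 3) (LaurentSeries K)) :
    Matrix (Fin 3) (Fin 3) (LaurentSeries K)) = Matrix.diagonal fun i => tt K ^ (![m, n, 0] i) := by
  have : ((xx K m n : GL (Fin 3) (LaurentSeries K)) :
    Matrix (Fin 3) (Fin 3) (LaurentSeries K)) = Matrix.diagonal ![tt K ^ m, tt K ^ n, 1] := rfl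
  rw [this]
  congr 1
  funext i
  fin_cases i <;> simp

lemma xx_inv_coe (m n : ℕ) : (((xx K m n)⁻¹ : GL (Fin 3) (LaurentSeries K)) :
    Matrix (Fin 3) (Fin 3) (LaurentSeries K))
      = Matrix.diagonal fun i => (tt K ^ (![m, n, 0] i))⁻¹ := by
  rw [Matrix.coe_units_inv, xx_coe]
  apply Matrix.inv_eq_left_inv
  rw [Matrix.diagonal_mul_diagonal, ← Matrix.diagonal_one]
  congr 1
  funext i
  exact inv_mul_cancel₀ (pow_ne_zero _ (tt_ne_zero K))

lemma conj_apply (m n : ℕ) (g : GL (Fin 3) (LaurentSeries K)) (i j : Fin 3) :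
    (((xx K m n)⁻¹ * g * xx K m n : GL (Fin 3) (LaurentSeries K)) :
      Matrix (Fin 3) (Fin 3) (LaurentSeries K)) i j
    = (tt K ^ (![m, n, 0] i))⁻¹ * (g : Matrix (Fin 3) (Fin 3) (LaurentSeries K)) i j
      * tt K ^ (![m, n, 0] j) := by
  rw [Units.val_mul, Units.val_mul, xx_coe, xx_inv_coe, Matrix.mul_diagonal, Matrix.diagonal_mul]

lemma conj_det (m n : ℕ) (g : GL (Fin 3) (LaurentSeries K)) :
    (((xx K m n)⁻¹ * g * xx K m n : GL (Fin 3) (LaurentSeries K)) :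
      Matrix (Fin 3) (Fin 3) (LaurentSeries K)).det
    = (g : Matrix (Fin 3) (Fin 3) (LaurentSeries K)).det := by
  have : Matrix.GeneralLinearGroup.det ((xx K m n)⁻¹ * g * xx K m n)
      = Matrix.GeneralLinearGroup.det g := by
    rw [map_mul, map_mul, map_inv, mul_comm, mul_inv_cancel_left]
  exact congrArg Units.val this

lemma det_ne (g : GL (Fin 3) (LaurentSeries K)) :
    (g : Matrix (Fin 3) (Fin 3) (LaurentSeries K)).det ≠ 0 :=
  (Matrix.GeneralLinearGroup.det g).ne_zero

lemma det_inv_mem (S : Subring (LaurentSeries K)) (g : GL (Fin 3) (LaurentSeries K))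
    (h : ∀ i j, ((g⁻¹ : GL (Fin 3) (LaurentSeries K)) :
      Matrix (Fin 3) (Fin 3) (LaurentSeries K)) i j ∈ S) :
    (g : Matrix (Fin 3) (Fin 3) (LaurentSeries K)).det⁻¹ ∈ S := by
  have := det_mem K S _ h
  rwa [Matrix.coe_units_inv, Matrix.det_nonsing_inv, Ring.inverse_eq_inv'] at this

lemma stab_general (m n : ℕ) :
    stab K m n = projPGL K '' {g : GL (Fin 3) (LaurentSeries K) |
      ∀ i j, Ent K (![m, n, 0] i) (![m, n, 0] j)
        ((g : Matrix (Fin 3) (Fin 3) (LaurentSeries K)) i j)} := by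
  ext γ
  constructor
  · rintro ⟨⟨g, ⟨hg1, hg2⟩, rfl⟩, ⟨w, ⟨hw1, hw2⟩, hw⟩⟩
    refine ⟨g, fun i j => ⟨hg1 i j, ?_⟩, rfl⟩
    have hw' : projPGL K w = projPGL K ((xx K m n)⁻¹ * g * xx K m n) := by
      rw [hw, map_mul, map_mul, map_inv]; rfl
    obtain ⟨c, hc⟩ := QuotientGroup.eq.1 hw'
    have hc' : (xx K m n)⁻¹ * g * xx K m n = w * Units.map ((Matrix.scalar (Fin 3) :
      LaurentSeries K →+* Matrix (Fin 3) (Fin 3) (LaurentSeries K))).toMonoidHom c := by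
      rw [hc, mul_inv_cancel_left]
    have hM : (((xx K m n)⁻¹ * g * xx K m n : GL (Fin 3) (LaurentSeries K)) :
      Matrix (Fin 3) (Fin 3) (LaurentSeries K)) =
        (w : Matrix (Fin 3) (Fin 3) (LaurentSeries K)) *
          Matrix.diagonal fun _ => (c : LaurentSeries K) := by
      rw [hc']; rfl
    have hd := congrArg Matrix.det hM
    rw [conj_det, Matrix.det_mul, Matrix.det_diagonal, Fin.prod_const] at hd
    have hgd : (g : Matrix (Fin 3) (Fin 3) (LaurentSeries K)).det ∈ Osub K :=
      Fq_le_O K (R_unit K (det_ne K g) (det_mem K _ _ hg1) (det_inv_mem K _ g hg2))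
    have hcO : (c : LaurentSeries K) ∈ Osub K := by
      apply O_of_cube
      have : (c : LaurentSeries K) ^ 3 = (w : Matrix (Fin 3) (Fin 3) (LaurentSeries K)).det⁻¹ *
          (g : Matrix (Fin 3) (Fin 3) (LaurentSeries K)).det := by
        rw [hd, inv_mul_cancel_left₀ (det_ne K w)]
      rw [this]
      exact mul_mem (det_inv_mem K _ w hw2) hgd
    rw [← conj_apply, hM, Matrix.mul_diagonal]
    exact mul_mem (hw1 i j) hcO
  · rintro ⟨g, hg, rfl⟩
    have hO : ∀ i j, (((xx K m n)⁻¹ * g * xx K m n : GL (Fin 3) (LaurentSeries K)) :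
      Matrix (Fin 3) (Fin 3) (LaurentSeries K)) i j ∈ Osub K := by
      intro i j; rw [conj_apply]; exact (hg i j).2
    have hdO := det_mem K _ _ hO
    rw [conj_det] at hdO
    have hdR : (g : Matrix (Fin 3) (Fin 3) (LaurentSeries K)).det ∈ Rsub K :=
      det_mem K _ _ fun i j => (hg i j).1
    have hdF := Fq_inv K ((ent_Fq K 0 _).1 ⟨hdR, by simpa using hdO⟩)
    refine ⟨⟨g, ⟨fun i j => (hg i j).1, ?_⟩, rfl⟩,
      ⟨(xx K m n)⁻¹ * g * xx K m n, ⟨hO, ?_⟩, ?_⟩⟩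
    · rw [Matrix.coe_units_inv]
      exact inv_mem_sub K _ _ (fun i j => (hg i j).1) (Fq_le_R K hdF)
    · rw [Matrix.coe_units_inv]
      refine inv_mem_sub K _ _ hO ?_
      rw [conj_det]; exact Fq_le_O K hdF
    · rw [map_mul, map_mul, map_inv]; rfl

/-- Explicit description of the stabilizers `Γ̄_{m,0}`, `Γ̄_{m,n}` (for `m > n > 0`) and
`Γ̄_{m,m}` as images in `PGL(3,F)` of explicit sets of invertible matrices. -/
theorem stab_descriptions :
    (∀ m : ℕ, 0 < m →
      stab K m 0 = projPGL K '' {g : GL (Fin 3) (LaurentSeries K) |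
        (g : Matrix (Fin 3) (Fin 3) (LaurentSeries K)) 0 0 ∈ Fqconst K ∧
        (g : Matrix (Fin 3) (Fin 3) (LaurentSeries K)) 0 1 ∈ Pdeg K m ∧
        (g : Matrix (Fin 3) (Fin 3) (LaurentSeries K)) 0 2 ∈ Pdeg K m ∧
        (g : Matrix (Fin 3) (Fin 3) (LaurentSeries K)) 1 0 = 0 ∧
        (g : Matrix (Fin 3) (Fin 3) (LaurentSeries K)) 1 1 ∈ Fqconst K ∧
        (g : Matrix (Fin 3) (Fin 3) (LaurentSeries K)) 1 2 ∈ Fqconst K ∧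
        (g : Matrix (Fin 3) (Fin 3) (LaurentSeries K)) 2 0 = 0 ∧
        (g : Matrix (Fin 3) (Fin 3) (LaurentSeries K)) 2 1 ∈ Fqconst K ∧
        (g : Matrix (Fin 3) (Fin 3) (LaurentSeries K)) 2 2 ∈ Fqconst K}) ∧
    (∀ m n : ℕ, n < m → 0 < n →
      stab K m n = projPGL K '' {g : GL (Fin 3) (LaurentSeries K) |
        (g : Matrix (Fin 3) (Fin 3) (LaurentSeries K)) 0 0 ∈ Fqconst K ∧
        (g : Matrix (Fin 3) (Fin 3) (LaurentSeries K)) 0 1 ∈ Pdeg K (m - n) ∧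
        (g : Matrix (Fin 3) (Fin 3) (LaurentSeries K)) 0 2 ∈ Pdeg K m ∧
        (g : Matrix (Fin 3) (Fin 3) (LaurentSeries K)) 1 0 = 0 ∧
        (g : Matrix (Fin 3) (Fin 3) (LaurentSeries K)) 1 1 ∈ Fqconst K ∧
        (g : Matrix (Fin 3) (Fin 3) (LaurentSeries K)) 1 2 ∈ Pdeg K n ∧
        (g : Matrix (Fin 3) (Fin 3) (LaurentSeries K)) 2 0 = 0 ∧
        (g : Matrix (Fin 3) (Fin 3) (LaurentSeries K)) 2 1 = 0 ∧
        (g : Matrix (Fin 3) (Fin 3) (LaurentSeries K)) 2 2 ∈ Fqconst K}) ∧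
    (∀ m : ℕ, 0 < m →
      stab K m m = projPGL K '' {g : GL (Fin 3) (LaurentSeries K) |
        (g : Matrix (Fin 3) (Fin 3) (LaurentSeries K)) 0 0 ∈ Fqconst K ∧
        (g : Matrix (Fin 3) (Fin 3) (LaurentSeries K)) 0 1 ∈ Fqconst K ∧
        (g : Matrix (Fin 3) (Fin 3) (LaurentSeries K)) 0 2 ∈ Pdeg K m ∧
        (g : Matrix (Fin 3) (Fin 3) (LaurentSeries K)) 1 0 ∈ Fqconst K ∧
        (g : Matrix (Fin 3) (Fin 3) (LaurentSeries K)) 1 1 ∈ Fqconst K ∧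
        (g : Matrix (Fin 3) (Fin 3) (LaurentSeries K)) 1 2 ∈ Pdeg K m ∧
        (g : Matrix (Fin 3) (Fin 3) (LaurentSeries K)) 2 0 = 0 ∧
        (g : Matrix (Fin 3) (Fin 3) (LaurentSeries K)) 2 1 = 0 ∧
        (g : Matrix (Fin 3) (Fin 3) (LaurentSeries K)) 2 2 ∈ Fqconst K}) := by
  refine ⟨fun m hm => ?_, fun m n hnm hn => ?_, fun m hm => ?_⟩
  · rw [stab_general]
    congr 1
    ext g
    simp only [Set.mem_setOf_eq, Fin.forall_fin_succ, Fin.isValue, Matrix.cons_val_zero,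
      Matrix.cons_val_succ, Fin.succ_zero_eq_one, Fin.succ_one_eq_two, IsEmpty.forall_iff,
      and_true]
    rw [ent_Fq, ent_Fq, ent_Fq, ent_Fq, ent_Fq, ent_P K m 0 m (by simp), ent_P K m 0 m (by simp),
      ent_zero K 0 m hm, ent_zero K 0 m hm]
    tauto
  · rw [stab_general]
    congr 1
    ext g
    simp only [Set.mem_setOf_eq, Fin.forall_fin_succ, Fin.isValue, Matrix.cons_val_zero,
      Matrix.cons_val_succ, Fin.succ_zero_eq_one, Fin.succ_one_eq_two, IsEmpty.forall_iff,
      and_true]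
    rw [ent_Fq, ent_Fq, ent_Fq, ent_P K m n (m - n) (by omega), ent_P K m 0 m (by simp),
      ent_P K n 0 n (by simp),
      ent_zero K 0 m (by omega), ent_zero K 0 n hn, ent_zero K n m hnm]
    tauto
  · rw [stab_general]
    congr 1
    ext g
    simp only [Set.mem_setOf_eq, Fin.forall_fin_succ, Fin.isValue, Matrix.cons_val_zero,
      Matrix.cons_val_succ, Fin.succ_zero_eq_one, Fin.succ_one_eq_two, IsEmpty.forall_iff,
      and_true]
    rw [ent_Fq, ent_Fq, ent_Fq, ent_Fq, ent_Fq, ent_P K m 0 m (by simp), ent_P K m 0 m (by simp),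
      ent_zero K 0 m hm, ent_zero K 0 m hm]
    tauto
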